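/- If the verifier wins a language game G = (V,E,v₀,𝓛) whose target language 𝓛 is recognised by a deterministic Rabin automaton 𝓡 with r states, then the verifier wins G using a strategy with memory of size r. -/

import Mathlib

noncomputable section
open scoped Classical

/-- `f` takes a value in `s` infinitely often. -/
def InfOft {β : Type*} (f : ℕ → β) (s : Set β) : Prop := {i | f i ∈ s}.Infinite

/-! ### Language games -/

/-- A star-shaped language game: the verifier owns the centre vertex `c`, the
spoiler owns the initial vertex `v₀` and the working vertices `W`.  `E0` is
the set of (labels of) edges from `v₀` to `c`, `EW w` the set of labels of
edges from the working vertex `w` to `c`; all of them are non-empty words.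
From `c` there is exactly one `ε`-labelled edge to each working vertex.  The
verifier's objective is that the produced ω-word lies in `target`. -/
structure LangGame (A W : Type*) where
  E0 : Set (List A)
  EW : W → Set (List A)
  E0ne : ∀ u ∈ E0, u ≠ []
  EWne : ∀ w, ∀ u ∈ EW w, u ≠ []
  target : Set (ℕ → A)

/-- A verifier strategy: given the history (the sequence of word/working-vertex
pairs played so far) and the word just played by the spoiler, choose the next
working vertex. -/
abbrev VStrat (A W : Type*) := List (List A × W) → List A → W

/-- A spoiler strategy: given the history, choose the next word (from `E0` at
the beginning, from `EW w` when at the working vertex `w`). -/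
abbrev SStrat (A W : Type*) := List (List A × W) → List A

/-- One round of the play. -/
def gStep {A W : Type*} (τ : VStrat A W) (ς : SStrat A W)
    (h : List (List A × W)) : List A × W :=
  (ς h, τ h (ς h))

/-- The history of the play after `i` rounds. -/
def gHist {A W : Type*} (τ : VStrat A W) (ς : SStrat A W) : ℕ → List (List A × W)
  | 0 => []
  | i + 1 => gHist τ ς i ++ [gStep τ ς (gHist τ ς i)]

/-- The ω-word produced by the play: the concatenation of the words played by
the spoiler. -/
def gOutcome {A W : Type*} [Inhabited A] (τ : VStrat A W) (ς : SStrat A W) :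
    ℕ → A := fun j => (((gHist τ ς (j + 1)).map Prod.fst).flatten).getD j default

/-- The spoiler strategy `ς` only plays available edges. -/
def ValidS {A W : Type*} (G : LangGame A W) (ς : SStrat A W) : Prop :=
  ς [] ∈ G.E0 ∧ ∀ (h : List (List A × W)) (u : List A) (w : W), ς (h ++ [(u, w)]) ∈ G.EW w

/-- The verifier strategy `τ` wins the game `G`. -/
def VerifierWinsWith {A W : Type*} [Inhabited A] (G : LangGame A W) (τ : VStrat A W) : Prop :=
  ∀ ς : SStrat A W, ValidS G ς → gOutcome τ ς ∈ G.target

/-- The verifier wins the game `G`. -/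
def VerifierWins {A W : Type*} [Inhabited A] (G : LangGame A W) : Prop :=
  ∃ τ : VStrat A W, VerifierWinsWith G τ

/-- `τ` is realised by a memory structure with `r` memory states, updated
along the edges of the play. -/
def HasMemory {A W : Type*} (r : ℕ) (τ : VStrat A W) : Prop :=
  ∃ (m0 : Fin r) (upd : Fin r → List A → Fin r) (ch : Fin r → W),
    ∀ h u, τ h u = ch (upd (h.foldl (fun m p => upd m p.1) m0) u)

/-- A deterministic (complete) Rabin automaton with transition-based
acceptance. -/
structure DetRabin (S A J : Type*) where
  s0 : S
  δ : S → A → S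
  Acc : J → Set (S × A × S)
  Rej : J → Set (S × A × S)

namespace DetRabin

variable {S A J : Type*} (R : DetRabin S A J)

/-- The run of `R` on the ω-word `α`. -/
def run (α : ℕ → A) : ℕ → S
  | 0 => R.s0
  | i + 1 => R.δ (run α i) (α i)

/-- The language of a deterministic Rabin automaton: for some index `j`,
infinitely many transitions of the run lie in `Acc j` and only finitely many
in `Rej j`. -/
def Lang : Set (ℕ → A) :=
  {α | ∃ j : J, InfOft (fun i => (R.run α i, α i, R.run α (i + 1))) (R.Acc j) ∧
      ¬ InfOft (fun i => (R.run α i, α i, R.run α (i + 1))) (R.Rej j)}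

/-- The state reached on a finite word. -/
def runList (u : List A) : S := u.foldl R.δ R.s0

end DetRabin

/-! ### Elementary facts about `InfOft` -/

theorem infOft_shift {β : Type*} (f : ℕ → β) (s : Set β) (k : ℕ) :
    InfOft (fun n => f (n + k)) s ↔ InfOft f s := by
  simp only [InfOft, ← Nat.frequently_atTop_iff_infinite]
  rw [← Filter.frequently_map (m := fun n => n + k) (P := fun n => f n ∈ s),
    Filter.map_add_atTop_eq_nat]

/-- Grouping positions into consecutive non-empty blocks `[L n, L (n + 1))` preserves whether
a property holds infinitely often. -/
theorem infinite_iff_infinite_blocks {L : ℕ → ℕ} (hL : StrictMono L) (h0 : L 0 = 0)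
    (P : ℕ → Prop) :
    {i | P i}.Infinite ↔ {n | ∃ i, L n ≤ i ∧ i < L (n + 1) ∧ P i}.Infinite := by
  simp only [← Nat.frequently_atTop_iff_infinite, Filter.frequently_atTop]
  constructor
  · intro h N
    obtain ⟨i, hi, hP⟩ := h (L N)
    have hex : ∃ n, i < L (n + 1) := ⟨i, hL.le_apply (x := i + 1)⟩
    refine ⟨Nat.find hex, ?_, i, ?_, Nat.find_spec hex, hP⟩
    · have := Nat.find_spec hex
      have := hL.lt_iff_lt.1 (hi.trans_lt this)
      omega
    · rcases hn : Nat.find hex with _ | n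
      · omega
      · exact not_lt.1 (Nat.find_min hex (m := n) (by omega))
  · intro h N
    obtain ⟨n, hn, i, hi, -, hP⟩ := h N
    exact ⟨i, (hn.trans hL.le_apply).trans hi, hP⟩

/-! ### Rabin games on finite arenas -/

/-- A Rabin arena: in state `s` the verifier picks `w`, then the spoiler picks a move
`e ∈ moves w`, which leads to the state `next s e`. -/
structure RabinArena (S W E J : Type) where
  moves : W → Set E
  next : S → E → S
  Acc : J → Set (S × E)
  Rej : J → Set (S × E)

namespace RabinArena

variable {S W E J : Type} (𝔸 : RabinArena S W E J)

/-- The Streett condition, which is the objective of the spoiler. -/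
def Streett (c : ℕ → S × E) : Prop := ∀ j, InfOft c (𝔸.Acc j) → InfOft c (𝔸.Rej j)

theorem streett_shift (c : ℕ → S × E) (k : ℕ) :
    𝔸.Streett (fun n => c (n + k)) ↔ 𝔸.Streett c := by
  simp only [Streett, infOft_shift]

/-- The positional verifier strategy `f` wins from the state `v`. -/
def PositionalWins (f : S → W) (v : S) : Prop :=
  ∀ (s : ℕ → S) (e : ℕ → E), s 0 = v → (∀ n, e n ∈ 𝔸.moves (f (s n))) →
    (∀ n, s (n + 1) = 𝔸.next (s n) (e n)) → ¬ 𝔸.Streett (fun n => (s n, e n))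

/-- A winning spoiler strategy, with memory `X`, against a verifier who in state `s` may only
pick elements of `C s`. It wins from every memory state in `dom`. -/
structure SpoilerStrategy (C : S → Set W) where
  X : Type
  dom : Set X
  pos : X → S
  move : X → W → E
  upd : X → W → X
  move_mem : ∀ x ∈ dom, ∀ w ∈ C (pos x), move x w ∈ 𝔸.moves w
  upd_mem : ∀ x ∈ dom, ∀ w ∈ C (pos x), upd x w ∈ dom
  pos_upd : ∀ x ∈ dom, ∀ w ∈ C (pos x), pos (upd x w) = 𝔸.next (pos x) (move x w)
  wins : ∀ (x : ℕ → X) (w : ℕ → W), x 0 ∈ dom → (∀ n, w n ∈ C (pos (x n))) →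
    (∀ n, x (n + 1) = upd (x n) (w n)) → 𝔸.Streett (fun n => (pos (x n), move (x n) (w n)))

/-- The spoiler wins from `v` when the verifier is restricted to `C`. -/
def SpoilerWins (C : S → Set W) (v : S) : Prop :=
  ∃ (σ : 𝔸.SpoilerStrategy C) (x : σ.X), x ∈ σ.dom ∧ σ.pos x = v

variable {𝔸}

theorem SpoilerStrategy.mem_dom {C : S → Set W} (σ : 𝔸.SpoilerStrategy C) {x : ℕ → σ.X}
    {w : ℕ → W} (h0 : x 0 ∈ σ.dom) (hw : ∀ n, w n ∈ C (σ.pos (x n)))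
    (hx : ∀ n, x (n + 1) = σ.upd (x n) (w n)) (n : ℕ) : x n ∈ σ.dom := by
  induction n with
  | zero => exact h0
  | succ n ih => rw [hx]; exact σ.upd_mem _ ih _ (hw n)

/-- The Streett condition holds along plays in which the strategy may be paused. -/
theorem SpoilerStrategy.wins_of_stutter {C : S → Set W} (σ : 𝔸.SpoilerStrategy C)
    {x : ℕ → σ.X} {w : ℕ → W} {act : ℕ → Prop} (h0 : x 0 ∈ σ.dom)
    (hw : ∀ n, act n → w n ∈ C (σ.pos (x n)))
    (hx : ∀ n, act n → x (n + 1) = σ.upd (x n) (w n))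
    (hid : ∀ n, ¬ act n → x (n + 1) = x n) (j : J)
    (hA : {n | act n ∧ (σ.pos (x n), σ.move (x n) (w n)) ∈ 𝔸.Acc j}.Infinite) :
    {n | act n ∧ (σ.pos (x n), σ.move (x n) (w n)) ∈ 𝔸.Rej j}.Infinite := by
  have hinf : {n | act n}.Infinite := hA.mono fun n hn => hn.1
  have hmono := Nat.nth_strictMono hinf
  have hact := Nat.nth_mem_of_infinite hinf
  have hconst : ∀ m k, (∀ i, m ≤ i → i < m + k → ¬ act i) → x (m + k) = x m := by
    intro m k
    induction k with
    | zero => intro _; rfl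
    | succ k ih =>
      intro h
      rw [← add_assoc, hid _ (h _ (by omega) (by omega)), ih fun i h1 h2 => h i h1 (by omega)]
  have hgap : ∀ i, act i → ∃ k, i = Nat.nth act k := fun i hi =>
    ⟨Nat.count act i, (Nat.nth_count hi).symm⟩
  have hfirst : x (Nat.nth act 0) = x 0 := by
    have := hconst 0 (Nat.nth act 0) fun i _ hi ha => by
      obtain ⟨k, rfl⟩ := hgap i ha
      have := hmono.lt_iff_lt.1 ((zero_add (Nat.nth act 0)) ▸ hi)
      omega
    simpa using this
  have hstep : ∀ k, x (Nat.nth act (k + 1)) =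
      σ.upd (x (Nat.nth act k)) (w (Nat.nth act k)) := by
    intro k
    rw [← hx _ (hact k)]
    have hlt : Nat.nth act k < Nat.nth act (k + 1) := hmono (Nat.lt_succ_self k)
    have := hconst (Nat.nth act k + 1) (Nat.nth act (k + 1) - (Nat.nth act k + 1))
      fun i h1 h2 ha => by
        obtain ⟨l, rfl⟩ := hgap i ha
        have h3 := hmono.lt_iff_lt.1 (show Nat.nth act k < Nat.nth act l by omega)
        have h4 := hmono.lt_iff_lt.1 (show Nat.nth act l < Nat.nth act (k + 1) by omega)
        omega
    rwa [Nat.add_sub_cancel' hlt] at this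
  have himage : ∀ P : ℕ → Prop,
      {n | act n ∧ P n}.Infinite ↔ {k | P (Nat.nth act k)}.Infinite := by
    intro P
    rw [← Set.infinite_image_iff (s := {k | P (Nat.nth act k)}) hmono.injective.injOn]
    refine iff_of_eq (congrArg _ ?_)
    ext n
    constructor
    · rintro ⟨ha, hP⟩
      obtain ⟨k, rfl⟩ := hgap n ha
      exact ⟨k, hP, rfl⟩
    · rintro ⟨k, hP, rfl⟩
      exact ⟨hact k, hP⟩
  rw [himage] at hA ⊢
  exact σ.wins (fun k => x (Nat.nth act k)) (fun k => w (Nat.nth act k))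
    (hfirst ▸ h0) (fun k => hw _ (hact k)) hstep j hA

/-- The positional verifier strategy and the spoiler strategy cannot both win from `v`. -/
theorem PositionalWins.not_spoilerWins {C : S → Set W} {f : S → W} (hf : ∀ s, f s ∈ C s)
    {v : S} (h : 𝔸.PositionalWins f v) : ¬ 𝔸.SpoilerWins C v := by
  rintro ⟨σ, x₀, hx₀, rfl⟩
  let x : ℕ → σ.X := fun n => Nat.rec x₀ (fun _ y => σ.upd y (f (σ.pos y))) n
  have hmem := σ.mem_dom (x := x) (w := fun n => f (σ.pos (x n))) hx₀ (fun n => hf _)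
    fun n => rfl
  exact h (fun n => σ.pos (x n)) (fun n => σ.move (x n) (f (σ.pos (x n)))) rfl
    (fun n => σ.move_mem _ (hmem n) _ (hf _)) (fun n => σ.pos_upd _ (hmem n) _ (hf _))
    (σ.wins x _ hx₀ (fun n => hf _) fun n => rfl)

/-- If the verifier has no choice at all, a losing play yields a winning spoiler strategy. -/
theorem spoilerWins_of_subsingleton {C : S → Set W} {f : S → W}
    (hC : ∀ s, ∀ w ∈ C s, w = f s) {v : S} (h : ¬ 𝔸.PositionalWins f v) :
    𝔸.SpoilerWins C v := by
  simp only [PositionalWins, not_forall, not_not] at h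
  obtain ⟨s, e, hs, he, hnext, hlose⟩ := h
  refine ⟨⟨ℕ, Set.univ, s, fun n _ => e n, fun n _ => n + 1, ?_, ?_, ?_, ?_⟩, 0, trivial, hs⟩
  · intro n _ w hw
    rw [hC _ w hw]
    exact he n
  · intros
    trivial
  · exact fun n _ _ _ => hnext n
  · intro x w _ _ hx
    have : ∀ n, x n = n + x 0 := by
      intro n
      induction n with
      | zero => simp
      | succ n ih => rw [hx, ih]; omega
    have h2 := (𝔸.streett_shift _ (x 0)).2 hlose
    simpa only [← this] using h2

/-- A spoiler strategy which never meets `v` does not care about the choices available at `v`. -/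
theorem SpoilerWins.of_not_spoilerWins {C C' : S → Set W} {v u : S} (hC : ∀ s ≠ v, C' s = C s)
    (hv : ¬ 𝔸.SpoilerWins C v) (hu : 𝔸.SpoilerWins C u) : 𝔸.SpoilerWins C' u := by
  obtain ⟨σ, x₀, hx₀, rfl⟩ := hu
  have key : ∀ x ∈ σ.dom, C' (σ.pos x) = C (σ.pos x) := fun x hx =>
    hC _ fun h => hv ⟨σ, x, hx, h⟩
  have hmem : ∀ x ∈ σ.dom, ∀ w ∈ C' (σ.pos x), w ∈ C (σ.pos x) := fun x hx w hw =>
    key x hx ▸ hw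
  refine ⟨⟨σ.X, σ.dom, σ.pos, σ.move, σ.upd, fun x hx w hw => σ.move_mem x hx w (hmem x hx w hw),
    fun x hx w hw => σ.upd_mem x hx w (hmem x hx w hw),
    fun x hx w hw => σ.pos_upd x hx w (hmem x hx w hw), ?_⟩, x₀, hx₀, rfl⟩
  intro x w h0 hw hx
  have hdom : ∀ n, x n ∈ σ.dom := by
    intro n
    induction n with
    | zero => exact h0
    | succ n ih => rw [hx]; exact σ.upd_mem _ ih _ (hmem _ ih _ (hw n))
  exact σ.wins x w h0 (fun n => hmem _ (hdom n) _ (hw n)) hx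

/-- If at `v` every choice in `C` is available in `C₁` or `C₂`, spoiler strategies against `C₁`
and `C₂` can be interleaved, switching between them at visits of `v`. -/
theorem SpoilerWins.interleave {C C₁ C₂ : S → Set W} {v u : S} (h₁ : ∀ s ≠ v, C s ⊆ C₁ s)
    (h₂ : ∀ s ≠ v, C s ⊆ C₂ s) (hv : C v ⊆ C₁ v ∪ C₂ v) (hu : 𝔸.SpoilerWins C₁ u)
    (hv₂ : 𝔸.SpoilerWins C₂ v) : 𝔸.SpoilerWins C u := by
  obtain ⟨σ, x₀, hx₀, rfl⟩ := hu
  obtain ⟨ρ, y₀, hy₀, hyv⟩ := hv₂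
  -- The Boolean records the active strategy; the inactive one waits at `v`.
  let X := σ.X × ρ.X × Bool
  let pos : X → S := fun p => if p.2.2 then ρ.pos p.2.1 else σ.pos p.1
  let act : X → W → Prop := fun p w => if pos p = v then w ∉ C₁ v else p.2.2 = true
  let dom : Set X := {p | p.1 ∈ σ.dom ∧ p.2.1 ∈ ρ.dom ∧
    (p.2.2 = true → σ.pos p.1 = v) ∧ (p.2.2 = false → ρ.pos p.2.1 = v)}
  let move : X → W → E := fun p w => if act p w then ρ.move p.2.1 w else σ.move p.1 w
  let upd : X → W → X := fun p w =>
    if act p w then (p.1, ρ.upd p.2.1 w, true) else (σ.upd p.1 w, p.2.1, false)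
  have hact : ∀ p ∈ dom, ∀ w ∈ C (pos p), act p w →
      pos p = ρ.pos p.2.1 ∧ σ.pos p.1 = v ∧ w ∈ C₂ (ρ.pos p.2.1) := by
    rintro ⟨x, y, b⟩ ⟨hx, hy, hb, hb'⟩ w hw ha
    by_cases hp : pos (x, y, b) = v
    · have ha' : w ∉ C₁ v := by simpa [act, hp] using ha
      have hw' : w ∈ C₂ v := (hv (hp ▸ hw)).resolve_left ha'
      cases b <;> simp_all [pos]
    · have ha' : b = true := by simpa [act, hp] using ha
      subst ha'
      have := h₂ _ hp hw
      simp_all [pos]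
  have hnact : ∀ p ∈ dom, ∀ w ∈ C (pos p), ¬ act p w →
      pos p = σ.pos p.1 ∧ ρ.pos p.2.1 = v ∧ w ∈ C₁ (σ.pos p.1) := by
    rintro ⟨x, y, b⟩ ⟨hx, hy, hb, hb'⟩ w hw ha
    by_cases hp : pos (x, y, b) = v
    · have ha' : w ∈ C₁ v := by simpa [act, hp] using ha
      cases b <;> simp_all [pos]
    · have ha' : b = false := by simpa [act, hp] using ha
      subst ha'
      have := h₁ _ hp hw
      simp_all [pos]
  have hupd : ∀ p ∈ dom, ∀ w ∈ C (pos p), upd p w ∈ dom := by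
    intro p hp w hw
    by_cases ha : act p w
    · obtain ⟨-, h3, h4⟩ := hact p hp w hw ha
      simp only [upd, ha, if_true]
      exact ⟨hp.1, ρ.upd_mem _ hp.2.1 _ h4, fun _ => h3, by simp⟩
    · obtain ⟨-, h3, h4⟩ := hnact p hp w hw ha
      simp only [upd, ha, if_false]
      exact ⟨σ.upd_mem _ hp.1 _ h4, hp.2.1, by simp, fun _ => h3⟩
  refine ⟨⟨X, dom, pos, move, upd, ?_, hupd, ?_, ?_⟩, (x₀, y₀, false),
    ⟨hx₀, hy₀, by simp, fun _ => hyv⟩, by simp [pos]⟩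
  · intro p hp w hw
    by_cases ha : act p w
    · simp only [move, ha, if_true]
      exact ρ.move_mem _ hp.2.1 _ (hact p hp w hw ha).2.2
    · simp only [move, ha, if_false]
      exact σ.move_mem _ hp.1 _ (hnact p hp w hw ha).2.2
  · intro p hp w hw
    by_cases ha : act p w
    · obtain ⟨h3, -, h4⟩ := hact p hp w hw ha
      rw [h3]
      simp only [move, upd, ha, if_true]
      exact ρ.pos_upd _ hp.2.1 _ h4
    · obtain ⟨h3, -, h4⟩ := hnact p hp w hw ha
      rw [h3]
      simp only [move, upd, ha, if_false]
      exact σ.pos_upd _ hp.1 _ h4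
  · intro p w h0 hw hp j hA
    have hdom : ∀ n, p n ∈ dom := by
      intro n
      induction n with
      | zero => exact h0
      | succ n ih => rw [hp]; exact hupd _ ih _ (hw n)
    have hcol : ∀ n, act (p n) (w n) →
        (pos (p n), move (p n) (w n)) = (ρ.pos (p n).2.1, ρ.move (p n).2.1 (w n)) := by
      intro n ha
      rw [(hact _ (hdom n) _ (hw n) ha).1]
      simp only [move, ha, if_true]
    have hcol' : ∀ n, ¬ act (p n) (w n) →
        (pos (p n), move (p n) (w n)) = (σ.pos (p n).1, σ.move (p n).1 (w n)) := by
      intro n ha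
      rw [(hnact _ (hdom n) _ (hw n) ha).1]
      simp only [move, ha, if_false]
    have hsplit : {n | (pos (p n), move (p n) (w n)) ∈ 𝔸.Acc j} ⊆
        {n | act (p n) (w n) ∧ (ρ.pos (p n).2.1, ρ.move (p n).2.1 (w n)) ∈ 𝔸.Acc j} ∪
        {n | ¬ act (p n) (w n) ∧ (σ.pos (p n).1, σ.move (p n).1 (w n)) ∈ 𝔸.Acc j} := by
      intro n hn
      by_cases ha : act (p n) (w n)
      · exact Or.inl ⟨ha, hcol n ha ▸ hn⟩
      · exact Or.inr ⟨ha, hcol' n ha ▸ hn⟩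
    rcases Set.infinite_union.1 (Set.Infinite.mono hsplit hA) with hinf | hinf
    · refine (ρ.wins_of_stutter (x := fun n => (p n).2.1) (act := fun n => act (p n) (w n))
        h0.2.1 (fun n ha => (hact _ (hdom n) _ (hw n) ha).2.2) ?_ ?_ j hinf).mono ?_
      · intro n ha
        simp only [hp n, upd, ha, if_true]
      · intro n ha
        simp only [hp n, upd, ha, if_false]
      · exact fun n hn => (congrArg (· ∈ 𝔸.Rej j) (hcol n hn.1)).mpr hn.2
    · refine (σ.wins_of_stutter (x := fun n => (p n).1) (act := fun n => ¬ act (p n) (w n))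
        h0.1 (fun n ha => (hnact _ (hdom n) _ (hw n) ha).2.2) ?_ ?_ j hinf).mono ?_
      · intro n ha
        simp only [hp n, upd, ha, if_false]
      · intro n ha
        simp only [hp n, upd, not_not.1 ha, if_true]
      · exact fun n hn => (congrArg (· ∈ 𝔸.Rej j) (hcol' n hn.1)).mpr hn.2

/-- Rabin games on finite arenas are determined, and the verifier has a single positional
strategy which wins from every state not won by the spoiler. -/
theorem exists_positional [Finite S] [Finite W] (C : S → Set W) (hC : ∀ s, (C s).Nonempty) :
    ∃ f : S → W, (∀ s, f s ∈ C s) ∧ ∀ v, 𝔸.PositionalWins f v ∨ 𝔸.SpoilerWins C v := by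
  induction C using WellFoundedLT.induction with
  | ind C ih =>
  by_cases hsub : ∀ s, (C s).Subsingleton
  · choose f hf using hC
    exact ⟨f, hf, fun v => or_iff_not_imp_left.2 fun h =>
      spoilerWins_of_subsingleton (fun s w hw => hsub s hw (hf s)) h⟩
  · push Not at hsub
    obtain ⟨v, a, ha, b, hb, hab⟩ := hsub
    have restrict : ∀ D : Set W, D ⊂ C v → D.Nonempty →
        ∃ f : S → W, (∀ s, f s ∈ Function.update C v D s) ∧
          (∀ s, f s ∈ C s) ∧
          ∀ u, 𝔸.PositionalWins f u ∨ 𝔸.SpoilerWins (Function.update C v D) u := by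
      intro D hD hne
      obtain ⟨f, hf, hdet⟩ := ih (Function.update C v D) (update_lt_self_iff.2 hD) (by
        intro s
        rcases eq_or_ne s v with rfl | hs
        · simpa using hne
        · simpa [hs] using hC s)
      refine ⟨f, hf, fun s => ?_, hdet⟩
      exact (update_le_self_iff.2 hD.le : Function.update C v D ≤ C) s (hf s)
    obtain ⟨f₁, -, hf₁, hdet₁⟩ := restrict (C v \ {a})
      ⟨Set.sdiff_subset, fun h => (h ha).2 rfl⟩ ⟨b, hb, hab.symm⟩
    obtain ⟨f₂, hf₂', hf₂, hdet₂⟩ := restrict {a}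
      ⟨by simpa using ha, fun h => hab (h hb).symm⟩ ⟨a, rfl⟩
    rcases hdet₂ v with hv | hv
    · exact ⟨f₂, hf₂, fun u => (hdet₂ u).imp_right fun hu =>
        hu.of_not_spoilerWins (v := v) (fun s hs => by simp [hs]) (hv.not_spoilerWins hf₂')⟩
    · refine ⟨f₁, hf₁, fun u => (hdet₁ u).imp_right fun hu =>
        hu.interleave (v := v) (fun s hs => by simp [hs]) (fun s hs => by simp [hs]) ?_ hv⟩
      intro w hw
      by_cases hwa : w = a <;> simp [hwa, hw]

end RabinArena

/-! ### From language games to Rabin arenas -/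

namespace DetRabin

variable {S A J : Type} (R : DetRabin S A J)

/-- The pairs of a state and a finite word whose run from that state takes a transition in `T`. -/
def Meets (T : Set (S × A × S)) : Set (S × List A) :=
  {p | ∃ (i : ℕ) (h : i < p.2.length), ((p.2.take i).foldl R.δ p.1, p.2[i],
    (p.2.take (i + 1)).foldl R.δ p.1) ∈ T}

/-- For an ω-word `α` which is the concatenation of non-empty words `u n`, with partial
concatenations `pre n`, the run of `R` can be analysed word by word. -/
theorem infOft_transitions_iff_infOft_meets [Inhabited A] {u pre : ℕ → List A} {α : ℕ → A}
    (h0 : pre 0 = []) (hs : ∀ n, pre (n + 1) = pre n ++ u n) (hu : ∀ n, u n ≠ [])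
    (hα : ∀ j, α j = (pre (j + 1)).getD j default) (T : Set (S × A × S)) :
    InfOft (fun i => (R.run α i, α i, R.run α (i + 1))) T ↔
      InfOft (fun n => (R.runList (pre n), u n)) (R.Meets T) := by
  have hL : StrictMono fun n => (pre n).length := strictMono_nat_of_lt_succ fun n => by
    have := List.length_pos_iff.2 (hu n)
    simp only [hs, List.length_append]
    omega
  have hpre : ∀ m n, m ≤ n → pre m <+: pre n := by
    intro m n hmn
    induction n, hmn using Nat.le_induction with
    | base => exact List.prefix_rfl
    | succ n _ ih => rw [hs]; exact ih.trans (List.prefix_append _ _)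
  have hget : ∀ n i (h : i < (pre n).length), α i = (pre n)[i] := by
    intro n i h
    have h' : i < (pre (i + 1)).length := hL.le_apply (x := i + 1)
    rw [hα, List.getD_eq_getElem _ _ h']
    rcases le_total n (i + 1) with hle | hle
    · exact ((hpre _ _ hle).getElem h).symm
    · exact (hpre _ _ hle).getElem h'
  have hrun : ∀ n i, i ≤ (pre n).length → R.run α i = ((pre n).take i).foldl R.δ R.s0 := by
    intro n i
    induction i with
    | zero => intro _; simp [run]
    | succ i ih =>
      intro h
      rw [List.take_succ_eq_append_getElem h, List.foldl_append, ← ih (by omega), ← hget n i h]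
      rfl
  have hrun' : ∀ n i, i ≤ (u n).length → R.run α ((pre n).length + i) =
      ((u n).take i).foldl R.δ (R.runList (pre n)) := by
    intro n i h
    rw [hrun (n + 1) _ (by simp [hs, h]), hs, List.take_length_add_append, List.foldl_append]
    rfl
  have hget' : ∀ n i (h : i < (u n).length), α ((pre n).length + i) = (u n)[i] := by
    intro n i h
    rw [hget (n + 1) _ (by simp [hs, h])]
    simp [hs]
  have key : ∀ n i (h : i < (u n).length),
      (R.run α ((pre n).length + i), α ((pre n).length + i), R.run α ((pre n).length + i + 1)) =
      (((u n).take i).foldl R.δ (R.runList (pre n)), (u n)[i],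
        ((u n).take (i + 1)).foldl R.δ (R.runList (pre n))) := by
    intro n i h
    rw [hrun' n i h.le, hget' n i h, add_assoc, hrun' n (i + 1) h]
  unfold InfOft
  rw [infinite_iff_infinite_blocks hL (by simp [h0])]
  refine iff_of_eq (congrArg _ ?_)
  ext n
  constructor
  · rintro ⟨i, h1, h2, hT⟩
    obtain ⟨k, rfl⟩ := Nat.exists_eq_add_of_le h1
    have hk : k < (u n).length := by
      simp only [hs, List.length_append] at h2
      omega
    exact ⟨k, hk, key n k hk ▸ hT⟩
  · rintro ⟨k, hk, hT⟩
    refine ⟨(pre n).length + k, by simp, by simp [hs, hk], ?_⟩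
    exact (congrArg (· ∈ T) (key n k hk)).mpr hT

end DetRabin

/-- The Rabin arena of a language game: its states are those of the automaton. -/
def LangGame.arena {A W S J : Type} (G : LangGame A W) (R : DetRabin S A J) :
    RabinArena S W (List A) J where
  moves := G.EW
  next s u := u.foldl R.δ s
  Acc j := R.Meets (R.Acc j)
  Rej j := R.Meets (R.Rej j)

theorem ValidS.ne_nil {A W : Type} {G : LangGame A W} {ς : SStrat A W} (h : ValidS G ς)
    (l : List (List A × W)) : ς l ≠ [] := by
  rcases List.eq_nil_or_concat' l with rfl | ⟨l, p, rfl⟩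
  · exact G.E0ne _ h.1
  · exact G.EWne _ _ (h.2 l p.1 p.2)

/-- The outcome of a play belongs to the language iff the sequence of its rounds, started after
the first word, violates the Streett condition. -/
theorem gOutcome_mem_lang_iff {A W S J : Type} [Inhabited A] {G : LangGame A W}
    (R : DetRabin S A J) (τ : VStrat A W) {ς : SStrat A W} (hς : ValidS G ς) :
    gOutcome τ ς ∈ R.Lang ↔ ¬ (G.arena R).Streett fun n =>
      (R.runList ((gHist τ ς (n + 1)).map Prod.fst).flatten, ς (gHist τ ς (n + 1))) := by
  have key := R.infOft_transitions_iff_infOft_meets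
    (u := fun n => ς (gHist τ ς n)) (pre := fun n => ((gHist τ ς n).map Prod.fst).flatten)
    (α := gOutcome τ ς) rfl (fun n => by simp [gHist, gStep]) (fun n => hς.ne_nil _)
    fun j => rfl
  rw [(G.arena R).streett_shift (fun n =>
      (R.runList ((gHist τ ς n).map Prod.fst).flatten, ς (gHist τ ς n))) 1]
  simp only [DetRabin.Lang, RabinArena.Streett, Set.mem_ofPred_eq, key, LangGame.arena, not_forall,
    exists_prop]

/-- A verifier strategy which wins the language game refutes every spoiler strategy in the
arena from a state reached by an initial word. -/
theorem not_spoilerWins_of_verifierWins {A W S J : Type} [Inhabited A] {G : LangGame A W}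
    {R : DetRabin S A J} (hL : R.Lang = G.target) (hwin : VerifierWins G) {u : List A}
    (hu : u ∈ G.E0) : ¬ (G.arena R).SpoilerWins (fun _ => Set.univ) (R.runList u) := by
  rintro ⟨σ, x₀, hx₀, hpos⟩
  obtain ⟨τ, hτ⟩ := hwin
  let mem : List (List A × W) → σ.X := fun l => l.foldl (fun x p => σ.upd x p.2) x₀
  have hmem : ∀ l, mem l ∈ σ.dom := by
    intro l
    induction l using List.reverseRecOn with
    | nil => exact hx₀
    | append_singleton l p ih =>
      simp only [mem, List.foldl_append]
      exact σ.upd_mem _ ih _ trivial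
  let ς : SStrat A W := fun l =>
    match l.getLast? with
    | none => u
    | some p => σ.move (mem l.dropLast) p.2
  have hς' : ∀ l p, ς (l ++ [p]) = σ.move (mem l) p.2 := fun l p => by simp [ς]
  have hς : ValidS G ς := ⟨hu, fun l u w => by
    rw [hς']
    exact σ.move_mem _ (hmem l) _ trivial⟩
  have hrun : ∀ n, R.runList ((gHist τ ς (n + 1)).map Prod.fst).flatten =
      σ.pos (mem (gHist τ ς n)) := by
    intro n
    induction n with
    | zero => simpa [gHist, gStep, mem, ς] using hpos.symm
    | succ n ih =>
      have h1 : mem (gHist τ ς (n + 1)) =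
          σ.upd (mem (gHist τ ς n)) (gStep τ ς (gHist τ ς n)).2 := by
        simp [mem, gHist]
      rw [h1, σ.pos_upd _ (hmem _) _ trivial, ← ih, gHist]
      have h2 : ς (gHist τ ς (n + 1)) =
          σ.move (mem (gHist τ ς n)) (gStep τ ς (gHist τ ς n)).2 := hς' _ _
      simp only [List.map_append, List.flatten_append, DetRabin.runList, List.foldl_append,
        List.map_cons, List.map_nil, List.flatten_cons, List.flatten_nil, List.append_nil]
      rw [← h2]
      rfl
  refine (gOutcome_mem_lang_iff R τ hς).1 (hL ▸ hτ ς hς) ?_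
  have := σ.wins (fun n => mem (gHist τ ς n)) (fun n => (gStep τ ς (gHist τ ς n)).2) hx₀
    (fun _ => trivial) fun n => by simp [mem, gHist]
  have heq : ∀ n, ς (gHist τ ς (n + 1)) =
      σ.move (mem (gHist τ ς n)) (gStep τ ς (gHist τ ς n)).2 := fun n => hς' _ _
  simpa only [hrun, heq] using this

/-- If the verifier wins a language game `G` whose target
language is recognised by a deterministic Rabin automaton `𝓡` with `r`
states, then the verifier wins `G` using a strategy with memory of size
`r`. -/
theorem verifier_wins_with_memory {A W S J : Type} [Inhabited A] [Finite W]
    [Finite S] [Finite J] (G : LangGame A W) (R : DetRabin S A J) (r : ℕ)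
    (hr : Nat.card S = r) (hL : R.Lang = G.target) (hwin : VerifierWins G) :
    ∃ τ : VStrat A W, HasMemory r τ ∧ VerifierWinsWith G τ := by
  obtain ⟨τ₀, -⟩ := id hwin
  obtain ⟨f, -, hf⟩ := RabinArena.exists_positional (𝔸 := G.arena R) (fun _ => Set.univ)
    fun _ => ⟨τ₀ [] [], trivial⟩
  let τ : VStrat A W := fun h u => f (R.runList ((h.map Prod.fst).flatten ++ u))
  refine ⟨τ, ?_, ?_⟩
  · let e : S ≃ Fin r := Finite.equivFinOfCardEq hr
    refine ⟨e R.s0, fun m u => e (u.foldl R.δ (e.symm m)), fun m => f (e.symm m), fun h u => ?_⟩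
    have hmem : h.foldl (fun m p => e (p.1.foldl R.δ (e.symm m))) (e R.s0) =
        e (R.runList (h.map Prod.fst).flatten) := by
      induction h using List.reverseRecOn with
      | nil => rfl
      | append_singleton h p ih => simp [ih, DetRabin.runList]
    simp [τ, hmem, DetRabin.runList]
  · intro ς hς
    rw [← hL, gOutcome_mem_lang_iff R τ hς]
    have hwins := (hf (R.runList (ς []))).resolve_right
      (not_spoilerWins_of_verifierWins hL hwin hς.1)
    refine hwins _ _ (by simp [gHist, gStep]) (fun n => ?_) fun n => ?_
    · have := hς.2 (gHist τ ς n) (ς (gHist τ ς n)) (τ (gHist τ ς n) (ς (gHist τ ς n)))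
      simpa [gHist, gStep, τ, LangGame.arena] using this
    · rw [gHist]
      simp [gStep, DetRabin.runList, LangGame.arena]
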